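/- Let n ≥ 1 be an integer and let f be a bounded continuous function on [0,∞) with f ∈ W²_0(ψ), D̃f ∈ W²_0(ψ), and both D̃f and D̃²f bounded and continuous on (0,∞) with limit 0 at x = 0. Then D̃(Ṽ_n f) = Ṽ_n(D̃f) on (0,∞). -/

import Mathlib

open MeasureTheory Filter Set

/-- Baskakov basis functions `P_{n,k}(x)`, with `P_{n,k} := 0` for `k < 0`. -/
noncomputable def P (n : ℕ) (k : ℤ) (x : ℝ) : ℝ :=
  if k < 0 then 0
  else (Nat.choose (n + k.toNat - 1) k.toNat : ℝ) * x ^ k.toNat * (1 + x) ^ (-(n : ℤ) - k)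

/-- The weight `ψ(x) = x(1+x)`. -/
noncomputable def psi (x : ℝ) : ℝ := x * (1 + x)

/-- The differential operator `D̃ f = ψ f''`. -/
noncomputable def Dt (f : ℝ → ℝ) : ℝ → ℝ := fun x => psi x * deriv (deriv f) x

/-- The functionals `v_{n,k}`. -/
noncomputable def v (n k : ℕ) (f : ℝ → ℝ) : ℝ :=
  if k = 0 then f 0
  else ((n : ℝ) + 1) * ∫ t in Set.Ioi (0 : ℝ), P (n + 2) ((k : ℤ) - 1) t * f t

/-- The Goodman–Sharma–Baskakov operator `V_n`. -/
noncomputable def V (n : ℕ) (f : ℝ → ℝ) (x : ℝ) : ℝ :=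
  ∑' k : ℕ, v n k f * P n (k : ℤ) x

/-- The modified operator `Ṽ_n`. -/
noncomputable def Vt (n : ℕ) (f : ℝ → ℝ) (x : ℝ) : ℝ :=
  ∑' k : ℕ, v n k f * (P n (k : ℤ) x - (1 / (n : ℝ)) * Dt (P n (k : ℤ)) x)

/-- Supremum norm on `[0,∞)`. -/
noncomputable def supNorm (f : ℝ → ℝ) : ℝ := ⨆ x ∈ Set.Ici (0 : ℝ), |f x|

/-- `f` is bounded and continuous on `[0,∞)`. -/
def BddContOn (f : ℝ → ℝ) : Prop :=
  ContinuousOn f (Set.Ici 0) ∧ ∃ M, ∀ x ∈ Set.Ici (0 : ℝ), |f x| ≤ M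

/-- The space `W²(ψ)`: `g, g'` (locally) differentiable on `(0,∞)` and `D̃ g` bounded. -/
def MemW2 (g : ℝ → ℝ) : Prop :=
  DifferentiableOn ℝ g (Set.Ioi 0) ∧ DifferentiableOn ℝ (deriv g) (Set.Ioi 0) ∧
    ∃ M, ∀ x ∈ Set.Ioi (0 : ℝ), |Dt g x| ≤ M

/-- The space `W²₀(ψ)`: members of `W²(ψ)` with `D̃ g(x) → 0` as `x → 0⁺`. -/
def MemW20 (g : ℝ → ℝ) : Prop :=
  MemW2 g ∧ Filter.Tendsto (Dt g) (nhdsWithin 0 (Set.Ioi 0)) (nhds 0)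

/-- The K-functional `K(f,t)`. -/
noncomputable def Kfun (f : ℝ → ℝ) (t : ℝ) : ℝ :=
  sInf {a : ℝ | ∃ g : ℝ → ℝ, MemW20 g ∧ MemW2 (Dt g) ∧
    a = supNorm (fun x => f x - g x) + t * supNorm (Dt (Dt g))}

/-- The function `T_{n,k}(x)`. -/
noncomputable def T (n : ℕ) (k : ℤ) (x : ℝ) : ℝ :=
  (k : ℝ) * ((k : ℝ) - 1) * (1 + x) / x - 2 * (k : ℝ) * ((n : ℝ) + (k : ℝ))
    + ((n : ℝ) + (k : ℝ)) * ((n : ℝ) + (k : ℝ) + 1) * x / (1 + x)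

lemma P_natCast (n k : ℕ) (x : ℝ) :
    P n (k : ℤ) x = (Nat.choose (n + k - 1) k : ℝ) * x ^ k * ((1 + x) ^ (n + k))⁻¹ := by
  have h : (-(n : ℤ) - k) = -((n + k : ℕ) : ℤ) := by push_cast; ring
  simp only [P, Int.toNat_natCast, h, zpow_neg, zpow_natCast]
  rw [if_neg (by omega)]

lemma P_of_neg (n : ℕ) {k : ℤ} (hk : k < 0) (x : ℝ) : P n k x = 0 := by
  simp [P, hk]

lemma P_natCast_nonneg (n k : ℕ) {x : ℝ} (hx : 0 ≤ x) : 0 ≤ P n (k : ℤ) x := by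
  rw [P_natCast]; positivity

lemma choose_identity (n k : ℕ) :
    (n : ℝ) * (n + k).choose k = (k + 1) * (n + k).choose (k + 1) := by
  have h := Nat.choose_succ_right_eq (n + k) k
  rw [Nat.add_sub_cancel] at h
  have h' : (((n + k).choose (k + 1) * (k + 1) : ℕ) : ℝ) = ((n + k).choose k * n : ℕ) := by
    rw [h]
  push_cast at h'
  linarith

lemma choose_succ_identity (n k : ℕ) :
    (n : ℝ) * (n + k + 1).choose (k + 1) = (n + k + 1) * (n + k).choose (k + 1) := by
  have h := Nat.add_one_mul_choose_eq (n + k) k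
  have h' : (((n + k + 1) * (n + k).choose k : ℕ) : ℝ)
      = ((n + k + 1).choose (k + 1) * (k + 1) : ℕ) := by rw [h]
  push_cast at h'
  have hk : (k : ℝ) + 1 ≠ 0 := by positivity
  have h2 := choose_identity n k
  apply mul_left_cancel₀ hk
  linear_combination (-(n : ℝ)) * h' + (n + k + 1 : ℝ) * h2

/-- `P_{n,k}' = n (P_{n+1,k-1} - P_{n+1,k})`. -/
lemma hasDerivAt_P (n : ℕ) (k : ℤ) {x : ℝ} (hx : 1 + x ≠ 0) :
    HasDerivAt (P n k) (n * (P (n + 1) (k - 1) x - P (n + 1) k x)) x := by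
  have hpow : ∀ m : ℕ, HasDerivAt (fun y : ℝ => ((1 + y) ^ m)⁻¹)
      (-(m : ℝ) * ((1 + x) ^ (m + 1))⁻¹) x := by
    intro m
    have h1 : HasDerivAt (fun y : ℝ => (1 + y) ^ m) (m * (1 + x) ^ (m - 1) * 1) x :=
      ((hasDerivAt_id x).const_add 1).pow m
    refine (h1.fun_inv (pow_ne_zero m hx)).congr_deriv ?_
    rcases m with _ | m
    · simp
    · simp only [Nat.add_sub_cancel]
      field_simp
      ring
  rcases lt_or_ge k 0 with hk | hk
  · have : P n k = fun _ => (0 : ℝ) := funext fun y => P_of_neg n hk y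
    rw [this, P_of_neg _ hk, P_of_neg _ (by omega)]
    simpa using hasDerivAt_const x (0 : ℝ)
  · obtain ⟨j, rfl⟩ := Int.eq_ofNat_of_zero_le hk
    have hfun : P n (j : ℤ) = fun y : ℝ =>
        (Nat.choose (n + j - 1) j : ℝ) * y ^ j * ((1 + y) ^ (n + j))⁻¹ :=
      funext fun y => P_natCast n j y
    rw [hfun]
    have h := ((hasDerivAt_pow j x).const_mul (Nat.choose (n + j - 1) j : ℝ)).mul (hpow (n + j))
    refine h.congr_deriv ?_
    rcases j with _ | j
    · rw [P_of_neg _ (by simp), P_natCast]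
      simp
    · have e : ((j + 1 : ℕ) : ℤ) - 1 = (j : ℕ) := by push_cast; ring
      rw [e, P_natCast, P_natCast]
      have i1 := choose_identity n j
      have i2 := choose_succ_identity n j
      have e1 : n + (j + 1) - 1 = n + j := by omega
      have e2 : n + 1 + j - 1 = n + j := by omega
      have e3 : n + 1 + (j + 1) - 1 = n + j + 1 := by omega
      have e4 : n + (j + 1) = n + j + 1 := by omega
      have e5 : n + 1 + j = n + j + 1 := by omega
      have e6 : n + 1 + (j + 1) = n + j + 1 + 1 := by omega
      rw [e1, e2, e3, e4, e5, e6]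
      simp only [Nat.add_sub_cancel]
      push_cast
      linear_combination (- x ^ j * ((1 + x) ^ (n + j + 1))⁻¹) * i1
        + (x ^ (j + 1) * ((1 + x) ^ (n + j + 1 + 1))⁻¹) * i2

/-- `n (n+1) ψ P_{n+2,k-1} = k (n+k) P_{n,k}`. -/
lemma psi_mul_P (n : ℕ) (k : ℤ) {x : ℝ} (hx : 1 + x ≠ 0) :
    (n : ℝ) * (n + 1) * (psi x * P (n + 2) (k - 1) x) = k * (n + k) * P n k x := by
  rcases lt_or_ge (k - 1) 0 with hk | hk
  · rw [P_of_neg _ hk]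
    rcases (show k < 0 ∨ k = 0 by omega) with hk | rfl
    · rw [P_of_neg _ hk]; simp
    · simp
  · obtain ⟨j, hj⟩ := Int.eq_ofNat_of_zero_le hk
    obtain rfl : k = ((j + 1 : ℕ) : ℤ) := by push_cast; omega
    rw [hj, P_natCast, P_natCast]
    have i1 := choose_identity (n + 1) j
    have i2 := choose_succ_identity n j
    have e1 : n + 2 + j - 1 = n + 1 + j := by omega
    have e2 : n + (j + 1) - 1 = n + j := by omega
    have e3 : n + 2 + j = n + j + 2 := by omega
    have e4 : n + (j + 1) = n + j + 1 := by omega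
    have e5 : n + 1 + j = n + j + 1 := by omega
    rw [e1, e2, e3, e4, e5]
    rw [e5] at i1
    push_cast at *
    have key : (n : ℝ) * (n + 1) * (n + j + 1).choose j
        = (j + 1) * (n + (j + 1)) * (n + j).choose (j + 1) := by
      linear_combination (n : ℝ) * i1 + (j + 1 : ℝ) * i2
    have hx2 : (1 + x) * ((1 + x) ^ (n + j + 2))⁻¹ = ((1 + x) ^ (n + j + 1))⁻¹ := by
      rw [show n + j + 2 = n + j + 1 + 1 by ring, pow_succ (1 + x) (n + j + 1)]
      field_simp
    unfold psi
    rw [← hx2]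
    linear_combination (x ^ (j + 1) * (1 + x) * ((1 + x) ^ (n + j + 2))⁻¹) * key

/-- The second derivative of `P_{n,k}`. -/
noncomputable def secondDerivP (n : ℕ) (k : ℤ) (x : ℝ) : ℝ :=
  n * (n + 1) * (P (n + 2) (k - 2) x - 2 * P (n + 2) (k - 1) x + P (n + 2) k x)

lemma hasDerivAt_P_sub_P (n : ℕ) (k : ℤ) {x : ℝ} (hx : 1 + x ≠ 0) :
    HasDerivAt (fun y => n * (P (n + 1) (k - 1) y - P (n + 1) k y)) (secondDerivP n k x) x := by
  refine (((hasDerivAt_P (n + 1) (k - 1) hx).sub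
    (hasDerivAt_P (n + 1) k hx)).const_mul (n : ℝ)).congr_deriv ?_
  rw [secondDerivP, show k - 1 - 1 = k - 2 by ring]
  push_cast
  ring

lemma Dt_P (n : ℕ) (k : ℤ) {x : ℝ} (hx : 0 < x) :
    Dt (P n k) x = (k - 1 : ℤ) * (n + (k - 1 : ℤ)) * P n (k - 1) x
      - 2 * (k * (n + k) * P n k x) + (k + 1 : ℤ) * (n + (k + 1 : ℤ)) * P n (k + 1) x := by
  have h1 : deriv (P n k) =ᶠ[nhds x] fun y => n * (P (n + 1) (k - 1) y - P (n + 1) k y) := by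
    filter_upwards [lt_mem_nhds hx] with y hy
    exact (hasDerivAt_P n k (by positivity)).deriv
  have hx' : 1 + x ≠ 0 := by positivity
  rw [Dt, h1.deriv_eq, (hasDerivAt_P_sub_P n k hx').deriv, secondDerivP, ← psi_mul_P n _ hx',
    ← psi_mul_P n _ hx', ← psi_mul_P n _ hx', show k - 1 - 1 = k - 2 by ring, add_sub_cancel_right]
  ring

/-- Sequences of at most polynomial growth. -/
def PolyGrowth (c : ℕ → ℝ) : Prop :=
  ∃ (C : ℝ) (m : ℕ), 0 ≤ C ∧ ∀ k, |c k| ≤ C * ((k : ℝ) + 1) ^ m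

namespace PolyGrowth

variable {c d : ℕ → ℝ}

lemma mul (hc : PolyGrowth c) (hd : PolyGrowth d) : PolyGrowth fun k => c k * d k := by
  obtain ⟨C, m, hC, h⟩ := hc
  obtain ⟨D, l, hD, h'⟩ := hd
  refine ⟨C * D, m + l, by positivity, fun k => ?_⟩
  rw [abs_mul, pow_add]
  calc |c k| * |d k| ≤ (C * ((k : ℝ) + 1) ^ m) * (D * ((k : ℝ) + 1) ^ l) :=
        mul_le_mul (h k) (h' k) (abs_nonneg _) (by positivity)
    _ = _ := by ring

lemma add (hc : PolyGrowth c) (hd : PolyGrowth d) : PolyGrowth fun k => c k + d k := by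
  obtain ⟨C, m, hC, h⟩ := hc
  obtain ⟨D, l, hD, h'⟩ := hd
  refine ⟨C + D, m + l, by positivity, fun k => (abs_add_le _ _).trans ?_⟩
  have h1 : (1 : ℝ) ≤ (k : ℝ) + 1 := by linarith [k.cast_nonneg (α := ℝ)]
  have hm : ((k : ℝ) + 1) ^ m ≤ ((k : ℝ) + 1) ^ (m + l) := pow_le_pow_right₀ h1 (by omega)
  have hl : ((k : ℝ) + 1) ^ l ≤ ((k : ℝ) + 1) ^ (m + l) := pow_le_pow_right₀ h1 (by omega)
  nlinarith [h k, h' k, mul_le_mul_of_nonneg_left hm hC, mul_le_mul_of_nonneg_left hl hD]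

lemma const (a : ℝ) : PolyGrowth fun _ => a := ⟨|a|, 0, abs_nonneg a, fun k => by simp⟩

lemma natCast : PolyGrowth fun k => (k : ℝ) :=
  ⟨1, 1, zero_le_one, fun k => by rw [abs_of_nonneg k.cast_nonneg]; simp⟩

lemma const_mul (a : ℝ) (hc : PolyGrowth c) : PolyGrowth fun k => a * c k := (const a).mul hc

lemma sub (hc : PolyGrowth c) (hd : PolyGrowth d) : PolyGrowth fun k => c k - d k := by
  simpa [sub_eq_add_neg] using hc.add (hd.const_mul (-1))

lemma comp_le (hc : PolyGrowth c) {φ : ℕ → ℕ} (hφ : ∀ k, φ k ≤ 2 * k + 1) :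
    PolyGrowth fun k => c (φ k) := by
  obtain ⟨C, m, hC, h⟩ := hc
  refine ⟨C * 2 ^ m, m, by positivity, fun k => (h _).trans ?_⟩
  rw [mul_assoc, ← mul_pow]
  have : (φ k : ℝ) ≤ 2 * k + 1 := by exact_mod_cast hφ k
  gcongr
  linarith

lemma succ (hc : PolyGrowth c) : PolyGrowth fun k => c (k + 1) := hc.comp_le fun k => by omega

lemma pred (hc : PolyGrowth c) : PolyGrowth fun k => c (k - 1) := hc.comp_le fun k => by omega

lemma of_abs_le (hd : PolyGrowth d) (h : ∀ k, |c k| ≤ d k) : PolyGrowth c := by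
  obtain ⟨D, l, hD, h'⟩ := hd
  exact ⟨D, l, hD, fun k => (h k).trans ((le_abs_self _).trans (h' k))⟩

lemma choose (n : ℕ) : PolyGrowth fun k => ((n + k - 1).choose k : ℝ) := by
  refine ⟨((n : ℝ) + 1) ^ n, n, by positivity, fun k => ?_⟩
  rw [abs_of_nonneg (Nat.cast_nonneg _), ← mul_pow]
  have h : (n + k - 1).choose k ≤ (n + k) ^ n := by
    calc (n + k - 1).choose k ≤ (n + k).choose k := Nat.choose_le_choose _ (by omega)
      _ = (n + k).choose n := by rw [Nat.choose_symm_add]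
      _ ≤ _ := Nat.choose_le_pow _ _
  calc ((n + k - 1).choose k : ℝ) ≤ ((n : ℝ) + k) ^ n := by exact_mod_cast h
    _ ≤ _ := by
      gcongr
      nlinarith [n.cast_nonneg (α := ℝ), k.cast_nonneg (α := ℝ)]

lemma summable_mul_geometric (hc : PolyGrowth c) {r : ℝ} (h0 : 0 ≤ r) (h1 : r < 1) :
    Summable fun k => |c k| * r ^ k := by
  obtain ⟨C, m, hC, h⟩ := hc
  have hr : ‖r‖ < 1 := by rwa [Real.norm_of_nonneg h0]
  have hs := ((summable_pow_mul_geometric_of_norm_lt_one m hr).add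
    (summable_geometric_of_norm_lt_one hr)).mul_left (C * 2 ^ (m - 1))
  refine Summable.of_nonneg_of_le (fun k => mul_nonneg (abs_nonneg _) (pow_nonneg h0 k))
    (fun k => ?_) hs
  have h2 := add_pow_le k.cast_nonneg (zero_le_one (α := ℝ)) m
  rw [one_pow] at h2
  have h3 := (h k).trans (mul_le_mul_of_nonneg_left h2 hC)
  refine (mul_le_mul_of_nonneg_right h3 (pow_nonneg h0 k)).trans (le_of_eq ?_)
  ring

end PolyGrowth

lemma P_natCast_le (n k : ℕ) {x R : ℝ} (hx : 0 ≤ x) (hxR : x ≤ R) :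
    P n (k : ℤ) x ≤ (Nat.choose (n + k - 1) k : ℝ) * (R / (1 + R)) ^ k := by
  rw [P_natCast, mul_assoc]
  gcongr
  have h1 : ((1 + x) ^ (n + k))⁻¹ ≤ ((1 + x) ^ k)⁻¹ := by
    gcongr
    · linarith
    · omega
  calc x ^ k * ((1 + x) ^ (n + k))⁻¹ ≤ x ^ k * ((1 + x) ^ k)⁻¹ := by gcongr
    _ = (x / (1 + x)) ^ k := by rw [div_pow, div_eq_mul_inv]
    _ ≤ _ := by
      gcongr ?_ ^ k
      rw [div_le_div_iff₀ (by positivity) (by linarith)]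
      nlinarith

lemma summable_bound (n : ℕ) {c : ℕ → ℝ} (hc : PolyGrowth c) {R : ℝ} (hR : 0 ≤ R) :
    Summable fun k => |c k| * ((Nat.choose (n + k - 1) k : ℝ) * (R / (1 + R)) ^ k) := by
  have hr : R / (1 + R) < 1 := by rw [div_lt_one (by positivity)]; linarith
  refine ((hc.mul (PolyGrowth.choose n)).summable_mul_geometric (by positivity) hr).congr
    fun k => ?_
  rw [abs_mul, Nat.abs_cast, mul_assoc]

lemma summable_mul_P (n : ℕ) {c : ℕ → ℝ} (hc : PolyGrowth c) {x : ℝ} (hx : 0 ≤ x) :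
    Summable fun k : ℕ => c k * P n (k : ℤ) x := by
  refine (summable_bound n hc hx).of_norm_bounded fun k => ?_
  rw [norm_mul, Real.norm_eq_abs, Real.norm_of_nonneg (P_natCast_nonneg n k hx)]
  gcongr
  exact P_natCast_le n k hx le_rfl

/-- The series `∑ c_k P_{n,k}(x)`. -/
noncomputable def baskakovSeries (n : ℕ) (c : ℕ → ℝ) (x : ℝ) : ℝ :=
  ∑' k : ℕ, c k * P n (k : ℤ) x

/-- Index shift: `∑ c_k q_{k-1} = ∑ c_{k+1} q_k` when `q_{-1} = 0`. -/
lemma hasSum_mul_pred {c : ℕ → ℝ} {q : ℤ → ℝ} (hq : q (-1) = 0)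
    (hs : Summable fun k : ℕ => c (k + 1) * q k) :
    HasSum (fun k : ℕ => c k * q (k - 1)) (∑' k : ℕ, c (k + 1) * q k) := by
  rw [← hasSum_nat_add_iff' 1]
  simpa [hq] using hs.hasSum

/-- Index shift: `∑ c_k q_{k+1} = ∑ c_{k-1} q_k` when `q_0 = 0`. -/
lemma hasSum_mul_succ {c : ℕ → ℝ} {q : ℤ → ℝ} (hq : q 0 = 0)
    (hs : Summable fun k : ℕ => c (k - 1) * q k) :
    HasSum (fun k : ℕ => c k * q (k + 1)) (∑' k : ℕ, c (k - 1) * q k) := by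
  have := (hasSum_nat_add_iff' 1).2 hs.hasSum
  simpa [hq] using this

lemma hasDerivAt_baskakovSeries (n : ℕ) {c : ℕ → ℝ} (hc : PolyGrowth c) {x : ℝ} (hx : 0 < x) :
    HasDerivAt (baskakovSeries n c)
      (n * baskakovSeries (n + 1) (fun k => c (k + 1) - c k) x) x := by
  have hR : 0 ≤ x + 1 := by positivity
  set u : ℕ → ℝ := fun k => |c k| * ((Nat.choose (n + 1 + k - 1) k : ℝ) *
    ((x + 1) / (1 + (x + 1))) ^ k) with hu
  set u' : ℕ → ℝ := fun k => |c (k + 1)| * ((Nat.choose (n + 1 + k - 1) k : ℝ) *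
    ((x + 1) / (1 + (x + 1))) ^ k) with hu'
  have hus : Summable u := summable_bound (n + 1) hc hR
  have hus' : Summable u' := summable_bound (n + 1) hc.succ hR
  have hw : Summable fun k : ℕ => if k = 0 then 0 else u' (k - 1) := by
    rw [← summable_nat_add_iff 1]; simpa using hus'
  have key : HasDerivAt (baskakovSeries n c)
      (∑' k : ℕ, c k * (n * (P (n + 1) (k - 1) x - P (n + 1) k x))) x := by
    refine hasDerivAt_tsum_of_isPreconnected
      (u := fun k => n * ((if k = 0 then 0 else u' (k - 1)) + u k))
      (t := Set.Ioo 0 (x + 1)) (y₀ := x) ((hw.add hus).mul_left _) isOpen_Ioo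
      isPreconnected_Ioo (fun k y hy => (hasDerivAt_P n k ?_).const_mul (c k)) (fun k y hy => ?_)
      ⟨hx, by linarith⟩ (summable_mul_P n hc hx.le) ⟨hx, by linarith⟩
    · have := hy.1; positivity
    · have h1 : |c k * P (n + 1) (k : ℤ) y| ≤ u k := by
        rw [abs_mul, abs_of_nonneg (P_natCast_nonneg _ k hy.1.le)]
        exact mul_le_mul_of_nonneg_left (P_natCast_le _ k hy.1.le hy.2.le) (abs_nonneg _)
      have h2 : |c k * P (n + 1) (k - 1 : ℤ) y| ≤ if k = 0 then 0 else u' (k - 1) := by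
        rcases k with _ | k
        · simp [P_of_neg]
        · rw [if_neg (by omega), Nat.add_sub_cancel, abs_mul]
          push_cast
          rw [add_sub_cancel_right, abs_of_nonneg (P_natCast_nonneg _ k hy.1.le)]
          exact mul_le_mul_of_nonneg_left (P_natCast_le _ k hy.1.le hy.2.le) (abs_nonneg _)
      rw [Real.norm_eq_abs, show c k * (n * (P (n + 1) (k - 1) y - P (n + 1) k y))
        = n * (c k * P (n + 1) (k - 1) y - c k * P (n + 1) k y) by ring, abs_mul,
        abs_of_nonneg n.cast_nonneg]
      gcongr
      exact (abs_sub _ _).trans (add_le_add h2 h1)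
  refine key.congr_deriv ?_
  have s0 := summable_mul_P (n + 1) hc hx.le
  have s1 := summable_mul_P (n + 1) hc.succ hx.le
  have t1 := hasSum_mul_pred (q := fun k => P (n + 1) k x) (P_of_neg _ (by norm_num) x) s1
  rw [baskakovSeries]
  simp only [sub_mul]
  rw [s1.tsum_sub s0]
  rw [← ((t1.sub s0.hasSum).mul_left (n : ℝ)).tsum_eq]
  exact tsum_congr fun k => by ring

/-- The action of `D̃` on the coefficients of a Baskakov series. -/
def coeffDt (n : ℕ) (c : ℕ → ℝ) (k : ℕ) : ℝ :=
  (k : ℝ) * (n + k) * (c (k + 1) - 2 * c k + c (k - 1))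

lemma PolyGrowth.coeffDt (n : ℕ) {c : ℕ → ℝ} (hc : PolyGrowth c) : PolyGrowth (coeffDt n c) :=
  (natCast.mul ((const (n : ℝ)).add natCast)).mul ((hc.succ.sub (hc.const_mul 2)).add hc.pred)

lemma Dt_baskakovSeries (n : ℕ) {c : ℕ → ℝ} (hc : PolyGrowth c) {x : ℝ} (hx : 0 < x) :
    Dt (baskakovSeries n c) x = baskakovSeries n (coeffDt n c) x := by
  have hc' : PolyGrowth fun k => c (k + 1) - c k := hc.succ.sub hc
  have h1 : deriv (baskakovSeries n c) =ᶠ[nhds x]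
      fun y => n * baskakovSeries (n + 1) (fun k => c (k + 1) - c k) y := by
    filter_upwards [lt_mem_nhds hx] with y hy
    exact (hasDerivAt_baskakovSeries n hc hy).deriv
  rw [Dt, h1.deriv_eq, ((hasDerivAt_baskakovSeries (n + 1) hc' hx).const_mul (n : ℝ)).deriv]
  have hs := summable_mul_P n (hc.coeffDt n) hx.le
  rw [baskakovSeries, baskakovSeries, hs.tsum_eq_zero_add, ← tsum_mul_left, ← tsum_mul_left,
    ← tsum_mul_left]
  have h0 : coeffDt n c 0 = 0 := by simp [coeffDt]
  rw [h0, zero_mul, zero_add]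
  refine tsum_congr fun k => ?_
  have h := psi_mul_P n (k + 1 : ℕ) (x := x) (by positivity)
  push_cast at h ⊢
  rw [add_sub_cancel_right] at h
  simp only [coeffDt, Nat.add_sub_cancel]
  push_cast
  linear_combination (c (k + 1 + 1) - 2 * c (k + 1) + c k) * h

lemma hasSum_mul_Dt_P (n : ℕ) {c : ℕ → ℝ} (hc : PolyGrowth c) {x : ℝ} (hx : 0 < x) :
    HasSum (fun k : ℕ => c k * Dt (P n (k : ℤ)) x) (baskakovSeries n (coeffDt n c) x) := by
  set q : ℤ → ℝ := fun k => k * (n + k) * P n k x with hq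
  have hs : ∀ {d : ℕ → ℝ}, PolyGrowth d → Summable fun k : ℕ => d k * q k := by
    intro d hd
    refine (summable_mul_P n (hd.mul (PolyGrowth.natCast.mul
      ((PolyGrowth.const (n : ℝ)).add PolyGrowth.natCast))) hx.le).congr fun k => ?_
    simp [hq]; ring
  have t1 := hasSum_mul_pred (c := c) (q := q) (by simp [hq, P_of_neg]) (hs hc.succ)
  have t2 := hasSum_mul_succ (c := c) (q := q) (by simp [hq]) (hs hc.pred)
  have t0 := (hs hc).hasSum.mul_left 2
  have t := (t1.sub t0).add t2
  have e : baskakovSeries n (coeffDt n c) x = ∑' k : ℕ, c (k + 1) * q k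
      - 2 * ∑' k : ℕ, c k * q k + ∑' k : ℕ, c (k - 1) * q k := by
    rw [← tsum_mul_left, ← (hs hc.succ).tsum_sub ((hs hc).mul_left 2),
      ← ((hs hc.succ).sub ((hs hc).mul_left 2)).tsum_add (hs hc.pred), baskakovSeries]
    refine tsum_congr fun k => ?_
    simp only [coeffDt, hq]
    push_cast
    ring
  rw [e]
  have e' : (fun k : ℕ => c k * Dt (P n (k : ℤ)) x) = fun k : ℕ => c k * q (k - 1) -
      2 * (c k * q k) + c k * q (k + 1) := by
    funext k
    rw [Dt_P n k hx]
    simp only [hq]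
    ring
  rw [e']
  exact t

lemma Vt_eq_baskakovSeries (n : ℕ) {f : ℝ → ℝ} (hv : PolyGrowth fun k => v n k f) {x : ℝ}
    (hx : 0 < x) :
    Vt n f x = baskakovSeries n
      (fun k => v n k f - 1 / (n : ℝ) * coeffDt n (fun j => v n j f) k) x := by
  have h1 := (summable_mul_P n hv hx.le)
  have h2 := hasSum_mul_Dt_P n hv hx
  have h3 := summable_mul_P n (hv.coeffDt n) hx.le
  have h4 := (h1.hasSum.sub (h2.mul_left (1 / (n : ℝ)))).tsum_eq
  have h5 := (h1.hasSum.sub (h3.hasSum.mul_left (1 / (n : ℝ)))).tsum_eq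
  rw [Vt, baskakovSeries]
  refine Eq.trans (tsum_congr fun k => by ring) (h4.trans (h5.symm.trans ?_))
  exact tsum_congr fun k => by ring

lemma P_natCast_le_of_le {n k a b : ℕ} (ha : a ≤ k) (hb : b ≤ n + a) {x : ℝ} (hx : 0 ≤ x) :
    P n (k : ℤ) x ≤ (Nat.choose (n + k - 1) k : ℝ) * (x ^ a * ((1 + x) ^ b)⁻¹) := by
  rw [P_natCast, mul_assoc]
  refine mul_le_mul_of_nonneg_left ?_ (Nat.cast_nonneg _)
  have hx1 : 1 ≤ 1 + x := by linarith
  rw [← div_eq_mul_inv, ← div_eq_mul_inv, div_le_div_iff₀ (by positivity) (by positivity)]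
  calc x ^ k * (1 + x) ^ b = x ^ a * (x ^ (k - a) * (1 + x) ^ b) := by
        rw [← mul_assoc, ← pow_add, Nat.add_sub_cancel' ha]
    _ ≤ x ^ a * ((1 + x) ^ (k - a) * (1 + x) ^ b) := by gcongr; linarith
    _ = x ^ a * (1 + x) ^ (k - a + b) := by rw [pow_add]
    _ ≤ x ^ a * (1 + x) ^ (n + k) :=
        mul_le_mul_of_nonneg_left (pow_le_pow_right₀ hx1 (by omega)) (by positivity)

lemma abs_P_mul_le (n k : ℕ) {t y M : ℝ} (ht : 0 ≤ t) (hy : |y| ≤ M) :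
    |P (n + 2) (k : ℤ) t * y|
      ≤ (Nat.choose (n + 2 + k - 1) k : ℝ) * M * (1 + t ^ 2)⁻¹ := by
  have h := P_natCast_le_of_le (n := n + 2) (k := k) (a := 0) (b := 2) (by omega) (by omega) ht
  have h2 : ((1 + t) ^ 2)⁻¹ ≤ (1 + t ^ 2)⁻¹ := by
    gcongr
    nlinarith
  rw [abs_mul, abs_of_nonneg (P_natCast_nonneg _ _ ht), mul_right_comm]
  refine mul_le_mul (h.trans ?_) hy (abs_nonneg _) (by positivity)
  rw [pow_zero, one_mul]
  gcongr

lemma continuousOn_P (n : ℕ) (k : ℤ) : ContinuousOn (P n k) (Ici 0) := fun x hx =>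
  (hasDerivAt_P n k (by have : (0 : ℝ) ≤ x := hx; positivity)).continuousAt.continuousWithinAt

lemma integrableOn_P_mul (n : ℕ) (k : ℤ) {g : ℝ → ℝ} (hg : ContinuousOn g (Ioi 0)) {M : ℝ}
    (hM : ∀ t ∈ Ioi (0 : ℝ), |g t| ≤ M) :
    IntegrableOn (fun t => P (n + 2) k t * g t) (Ioi 0) := by
  rcases lt_or_ge k 0 with hk | hk
  · simp [P_of_neg _ hk]
  · obtain ⟨j, rfl⟩ := Int.eq_ofNat_of_zero_le hk
    refine Integrable.mono' ((integrable_inv_one_add_sq.const_mul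
      ((Nat.choose (n + 2 + j - 1) j : ℝ) * M)).integrableOn)
      ((((continuousOn_P _ _).mono Ioi_subset_Ici_self).mul hg).aestronglyMeasurable
        measurableSet_Ioi) ?_
    filter_upwards [ae_restrict_mem measurableSet_Ioi] with t ht
    exact abs_P_mul_le n j (le_of_lt ht) (hM t ht)

lemma polyGrowth_v (n : ℕ) {g : ℝ → ℝ} {M : ℝ} (hM : ∀ t ∈ Ioi (0 : ℝ), |g t| ≤ M) :
    PolyGrowth fun k => v n k g := by
  have hint : ∀ j : ℕ, |∫ t in Ioi (0 : ℝ), P (n + 2) (j : ℤ) t * g t|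
      ≤ (Nat.choose (n + 2 + j - 1) j : ℝ) * M * ∫ t in Ioi (0 : ℝ), (1 + t ^ 2)⁻¹ := by
    intro j
    rw [← integral_const_mul]
    rw [← Real.norm_eq_abs]
    refine norm_integral_le_of_norm_le (Integrable.integrableOn
      (integrable_inv_one_add_sq.const_mul ((Nat.choose (n + 2 + j - 1) j : ℝ) * M))) ?_
    filter_upwards [ae_restrict_mem measurableSet_Ioi] with t ht
    exact abs_P_mul_le n j (le_of_lt ht) (hM t ht)
  set A := M * ∫ t in Ioi (0 : ℝ), (1 + t ^ 2)⁻¹ with hA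
  have hd : PolyGrowth fun k => |g 0| + ((n : ℝ) + 1) *
      (|A| * (Nat.choose (n + 2 + (k - 1) - 1) (k - 1) : ℝ)) :=
    (PolyGrowth.const _).add (((PolyGrowth.choose (n + 2)).pred.const_mul _).const_mul _)
  refine hd.of_abs_le fun k => ?_
  rcases k with _ | k
  · simp only [v, if_true]
    exact le_add_of_nonneg_right (by positivity)
  · have e : ((k + 1 : ℕ) : ℤ) - 1 = (k : ℕ) := by push_cast; ring
    simp only [v, if_neg (Nat.succ_ne_zero k), e, Nat.add_sub_cancel]
    rw [abs_mul, abs_of_nonneg (by positivity : (0 : ℝ) ≤ (n : ℝ) + 1)]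
    refine le_add_of_nonneg_of_le (abs_nonneg _) ?_
    gcongr
    refine (hint k).trans ?_
    rw [mul_assoc, ← hA, mul_comm]
    gcongr
    exact le_abs_self A

/-- If `x f''(x)` is bounded, then `f'` grows at most logarithmically. -/
lemma abs_deriv_le_log {f : ℝ → ℝ} (hf : DifferentiableOn ℝ (deriv f) (Ioi 0)) {M : ℝ}
    (hM : ∀ x ∈ Ioi (0 : ℝ), |Dt f x| ≤ M) {x : ℝ} (hx : 0 < x) :
    |deriv f x| ≤ |deriv f 1| + M * |Real.log x| := by
  have hbd : ∀ y : ℝ, 0 < y → |deriv (deriv f) y| ≤ M * y⁻¹ := by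
    intro y hy
    have h := hM y hy
    rw [Dt, psi, abs_mul, abs_of_nonneg (by positivity)] at h
    rw [← div_eq_mul_inv, le_div_iff₀ hy]
    nlinarith [abs_nonneg (deriv (deriv f) y), mul_nonneg (mul_nonneg hy.le hy.le)
      (abs_nonneg (deriv (deriv f) y))]
  have hd : ∀ y : ℝ, 0 < y → HasDerivAt (deriv f) (deriv (deriv f) y) y := fun y hy =>
    (hf.differentiableAt (Ioi_mem_nhds hy)).hasDerivAt
  have mono : ∀ s : ℝ, |s| ≤ 1 → MonotoneOn (fun y => M * Real.log y + s * deriv f y) (Ioi 0) := by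
    intro s hs
    have hd' : ∀ y : ℝ, 0 < y → HasDerivAt (fun y => M * Real.log y + s * deriv f y)
        (M * y⁻¹ + s * deriv (deriv f) y) y := fun y hy =>
      ((Real.hasDerivAt_log hy.ne').const_mul M).add ((hd y hy).const_mul s)
    refine monotoneOn_of_deriv_nonneg (convex_Ioi 0)
      (fun y hy => (hd' y hy).continuousAt.continuousWithinAt)
      (fun y hy => (hd' y (interior_subset hy)).differentiableAt.differentiableWithinAt)
      fun y hy => ?_
    rw [(hd' y (interior_subset hy)).deriv]
    have h1 : |s * deriv (deriv f) y| ≤ M * y⁻¹ := by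
      rw [abs_mul]
      exact (mul_le_of_le_one_left (abs_nonneg _) hs).trans (hbd y (interior_subset hy))
    linarith [neg_abs_le (s * deriv (deriv f) y)]
  have hp := mono 1 (by simp)
  have hm := mono (-1) (by simp)
  have h01 : (1 : ℝ) ∈ Ioi (0 : ℝ) := mem_Ioi.2 one_pos
  have key : |deriv f x - deriv f 1| ≤ M * |Real.log x| := by
    rcases le_total x 1 with h | h
    · have a := hp hx h01 h
      have b := hm hx h01 h
      simp only [Real.log_one] at a b
      rw [abs_of_nonpos (Real.log_nonpos hx.le h), abs_le]
      constructor <;> linarith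
    · have a := hp h01 hx h
      have b := hm h01 hx h
      simp only [Real.log_one] at a b
      rw [abs_of_nonneg (Real.log_nonneg h), abs_le]
      constructor <;> linarith
  have := abs_add_le (deriv f x - deriv f 1) (deriv f 1)
  rw [sub_add_cancel] at this
  linarith

lemma P_apply_zero (n k : ℕ) : P n (k : ℤ) 0 = if k = 0 then 1 else 0 := by
  rw [P_natCast]
  rcases k with _ | k <;> simp

lemma tendsto_P_atTop (n : ℕ) (k : ℤ) : Tendsto (P (n + 1) k) atTop (nhds 0) := by
  rcases lt_or_ge k 0 with hk | hk
  · simp [funext fun y => P_of_neg (n + 1) hk y]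
  · obtain ⟨j, rfl⟩ := Int.eq_ofNat_of_zero_le hk
    have h : Tendsto (fun t : ℝ => (Nat.choose (n + 1 + j - 1) j : ℝ) * (1 + t)⁻¹) atTop
        (nhds 0) := by
      simpa using (tendsto_inv_atTop_zero.comp
        (tendsto_atTop_add_const_left atTop (1 : ℝ) tendsto_id)).const_mul
          (Nat.choose (n + 1 + j - 1) j : ℝ)
    refine squeeze_zero' ?_ ?_ h
    · filter_upwards [eventually_ge_atTop 0] with t ht using P_natCast_nonneg _ _ ht
    · filter_upwards [eventually_ge_atTop 0] with t ht
      simpa using P_natCast_le_of_le (n := n + 1) (k := j) (a := 0) (b := 1) (by omega)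
        (by omega) ht

/-- Integration by parts against `P_{n,j+1}`. -/
lemma integral_P_mul_deriv_deriv {n : ℕ} (hn : 1 ≤ n) (j : ℕ) {f : ℝ → ℝ} (hf : BddContOn f)
    (hf' : DifferentiableOn ℝ f (Ioi 0)) (hf'' : DifferentiableOn ℝ (deriv f) (Ioi 0))
    {M : ℝ} (hM : ∀ x ∈ Ioi (0 : ℝ), |Dt f x| ≤ M)
    (hint : IntegrableOn (fun t => P n (j + 1 : ℕ) t * deriv (deriv f) t - secondDerivP n (j + 1 : ℕ) t * f t)
      (Ioi 0)) :
    ∫ t in Ioi (0 : ℝ), (P n (j + 1 : ℕ) t * deriv (deriv f) t - secondDerivP n (j + 1 : ℕ) t * f t)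
      = n * P (n + 1) j 0 * f 0 := by
  obtain ⟨hfc, B, hB⟩ := hf
  set C : ℝ := (Nat.choose (n + (j + 1) - 1) (j + 1) : ℝ) with hC
  have hC0 : 0 ≤ C := Nat.cast_nonneg _
  set K : ℝ := |deriv f 1| with hK
  have hM0 : 0 ≤ M := (abs_nonneg _).trans (hM 1 (mem_Ioi.2 one_pos))
  have hP : ∀ t : ℝ, 0 ≤ t → P n (j + 1 : ℕ) t ≤ C * (t ^ 1 * ((1 + t) ^ 2)⁻¹) := fun t ht =>
    P_natCast_le_of_le (by omega) (by omega) ht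
  have hd := fun (k : ℤ) (t : ℝ) (ht : 0 ≤ t) => hasDerivAt_P n k (x := t) (by positivity)
  set Q : ℝ → ℝ := fun y => n * (P (n + 1) ((j + 1 : ℕ) - 1) y - P (n + 1) (j + 1 : ℕ) y) with hQ
  have hQd : ∀ t : ℝ, 0 ≤ t → HasDerivAt Q (secondDerivP n (j + 1 : ℕ) t) t := fun t ht =>
    hasDerivAt_P_sub_P n (j + 1 : ℕ) (by positivity)
  have lim0 : Tendsto (fun t => P n (j + 1 : ℕ) t * deriv f t) (nhdsWithin 0 (Ici 0)) (nhds 0) := by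
    have hc : Continuous fun t : ℝ => C * (K * t + M * |t * Real.log t|) :=
      continuous_const.mul ((continuous_const.mul continuous_id).add
        (continuous_const.mul Real.continuous_mul_log.abs))
    have h0 : Tendsto (fun t : ℝ => C * (K * t + M * |t * Real.log t|)) (nhdsWithin 0 (Ici 0))
        (nhds 0) := by
      have := (hc.tendsto 0).mono_left (nhdsWithin_le_nhds (s := Ici 0))
      simpa using this
    refine squeeze_zero_norm' ?_ h0
    filter_upwards [self_mem_nhdsWithin] with t ht
    rcases (show (0 : ℝ) ≤ t from ht).eq_or_lt with rfl | ht
    · rw [P_apply_zero]; simp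
    · rw [Real.norm_eq_abs, abs_mul, abs_of_nonneg (P_natCast_nonneg _ _ ht.le), abs_mul,
        abs_of_pos ht]
      have h1 : P n (j + 1 : ℕ) t ≤ C * t := by
        refine (hP t ht.le).trans ?_
        rw [pow_one]
        gcongr
        exact mul_le_of_le_one_right ht.le (inv_le_one_of_one_le₀ (one_le_pow₀ (by linarith)))
      calc _ ≤ (C * t) * (K + M * |Real.log t|) :=
            mul_le_mul h1 (abs_deriv_le_log hf'' hM ht) (abs_nonneg _) (by positivity)
        _ = _ := by ring
  have limTop : Tendsto (fun t => P n (j + 1 : ℕ) t * deriv f t) atTop (nhds 0) := by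
    have hl : Tendsto (fun t : ℝ => Real.log t / t) atTop (nhds 0) :=
      Real.isLittleO_log_id_atTop.tendsto_div_nhds_zero
    have h0 : Tendsto (fun t : ℝ => C * (K * t⁻¹ + M * (Real.log t / t))) atTop (nhds 0) := by
      simpa using ((tendsto_inv_atTop_zero.const_mul K).add (hl.const_mul M)).const_mul C
    refine squeeze_zero_norm' ?_ h0
    filter_upwards [eventually_ge_atTop 1] with t ht
    have ht0 : 0 < t := by linarith
    have hb := abs_deriv_le_log hf'' hM ht0
    rw [abs_of_nonneg (Real.log_nonneg ht)] at hb
    rw [Real.norm_eq_abs, abs_mul, abs_of_nonneg (P_natCast_nonneg _ _ ht0.le)]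
    have h1 : P n (j + 1 : ℕ) t ≤ C * t⁻¹ := by
      refine (hP t ht0.le).trans ?_
      rw [pow_one]
      gcongr
      rw [← div_eq_mul_inv, ← one_div, div_le_div_iff₀ (by positivity) ht0]
      nlinarith
    calc _ ≤ (C * t⁻¹) * (K + M * Real.log t) :=
          mul_le_mul h1 hb (abs_nonneg _) (by positivity)
      _ = _ := by ring
  have limQ : Tendsto (fun t => Q t * f t) atTop (nhds 0) := by
    have hQ0 : Tendsto Q atTop (nhds 0) := by
      simpa using ((tendsto_P_atTop n _).sub (tendsto_P_atTop n _)).const_mul (n : ℝ)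
    have h0 : Tendsto (fun t => |Q t| * B) atTop (nhds 0) := by
      simpa using hQ0.abs.mul_const B
    refine squeeze_zero_norm' ?_ h0
    filter_upwards [eventually_ge_atTop 0] with t ht
    rw [Real.norm_eq_abs, abs_mul]
    exact mul_le_mul_of_nonneg_left (hB t ht) (abs_nonneg _)
  have hP0 : P n (j + 1 : ℕ) 0 = 0 := by rw [P_apply_zero]; simp
  have hcont : ContinuousWithinAt (fun t => P n (j + 1 : ℕ) t * deriv f t - Q t * f t) (Ici 0) 0 := by
    refine ContinuousWithinAt.sub ?_
      ((hQd 0 le_rfl).continuousAt.continuousWithinAt.mul (hfc 0 self_mem_Ici))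
    rw [ContinuousWithinAt, hP0, zero_mul]
    exact lim0
  have hderiv : ∀ t ∈ Ioi (0 : ℝ), HasDerivAt (fun t => P n (j + 1 : ℕ) t * deriv f t - Q t * f t)
      (P n (j + 1 : ℕ) t * deriv (deriv f) t - secondDerivP n (j + 1 : ℕ) t * f t) t := by
    intro t ht
    have h1 := (hf'.differentiableAt (Ioi_mem_nhds ht)).hasDerivAt
    have h2 := (hf''.differentiableAt (Ioi_mem_nhds ht)).hasDerivAt
    refine (((hd _ t (le_of_lt ht)).mul h2).sub ((hQd t (le_of_lt ht)).mul h1)).congr_deriv ?_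
    simp only [hQ]
    ring
  rw [integral_Ioi_of_hasDerivAt_of_tendsto hcont hderiv hint (by simpa using limTop.sub limQ)]
  have hP1 : P (n + 1) (j + 1 : ℕ) 0 = 0 := by rw [P_apply_zero]; simp
  simp only [hQ]
  rw [hP0, hP1]
  push_cast
  rw [add_sub_cancel_right]
  ring

/-- The functionals turn `D̃ f` into `coeffDt` of the coefficients of `f`. -/
lemma v_Dt {n : ℕ} (hn : 1 ≤ n) {f : ℝ → ℝ} (hf : BddContOn f) (hfW : MemW2 f)
    (hDf : ContinuousOn (Dt f) (Ioi 0)) (k : ℕ) :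
    v n k (Dt f) = coeffDt n (fun i => v n i f) k := by
  obtain ⟨hf', hf'', M, hM⟩ := hfW
  rcases k with _ | j
  · simp [v, Dt, psi, coeffDt]
  have hn0 : (n : ℝ) ≠ 0 := by positivity
  obtain ⟨B, hB⟩ := hf.2
  have hB' : ∀ t ∈ Ioi (0 : ℝ), |f t| ≤ B := fun t ht => hB t (mem_Ici.2 (le_of_lt ht))
  have hI := fun i : ℤ => integrableOn_P_mul n i (hf.1.mono Ioi_subset_Ici_self) hB'
  have hJ := integrableOn_P_mul n j hDf hM
  set I : ℤ → ℝ := fun i => ∫ t in Ioi (0 : ℝ), P (n + 2) i t * f t with hIdef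
  set q : ℝ := ((j + 1 : ℕ) : ℝ) * (n + (j + 1 : ℕ)) with hq
  have hq0 : q ≠ 0 := by positivity
  have hPf : ∀ t ∈ Ioi (0 : ℝ), P n (j + 1 : ℕ) t * deriv (deriv f) t
      = n * (n + 1) / q * (P (n + 2) j t * Dt f t) := by
    intro t ht
    have h := psi_mul_P n (j + 1 : ℕ) (x := t) (by have : (0 : ℝ) < t := ht; positivity)
    rw [show ((j + 1 : ℕ) : ℤ) - 1 = j by push_cast; ring] at h
    simp only [Int.cast_natCast] at h
    rw [← hq] at h
    rw [Dt]
    field_simp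
    linear_combination (-deriv (deriv f) t) * h
  have hi1 : IntegrableOn (fun t => P n (j + 1 : ℕ) t * deriv (deriv f) t) (Ioi 0) :=
    IntegrableOn.congr_fun (hJ.const_mul (n * (n + 1) / q)) (fun t ht => (hPf t ht).symm)
      measurableSet_Ioi
  have hexp : (fun t => secondDerivP n (j + 1 : ℕ) t * f t) = fun t => n * (n + 1) *
      (P (n + 2) (j - 1) t * f t - 2 * (P (n + 2) j t * f t) + P (n + 2) (j + 1) t * f t) := by
    funext t
    rw [secondDerivP, show ((j + 1 : ℕ) : ℤ) - 2 = j - 1 by push_cast; ring,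
      show ((j + 1 : ℕ) : ℤ) - 1 = j by push_cast; ring]
    push_cast
    ring
  have hi2 : IntegrableOn (fun t => secondDerivP n (j + 1 : ℕ) t * f t) (Ioi 0) := by
    rw [hexp]
    exact (((hI _).sub ((hI _).const_mul 2)).add (hI _)).const_mul _
  have e2 : ∫ t in Ioi (0 : ℝ), secondDerivP n (j + 1 : ℕ) t * f t
      = n * (n + 1) * (I (j - 1) - 2 * I j + I (j + 1)) := by
    have h1 := integral_sub (hI (j - 1)) ((hI j).const_mul 2)
    have h2 := integral_add ((hI (j - 1)).sub ((hI j).const_mul 2)) (hI (j + 1))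
    simp only [Pi.sub_apply] at h2
    rw [hexp, integral_const_mul, h2, h1, integral_const_mul]
  have e1 : ∫ t in Ioi (0 : ℝ), P n (j + 1 : ℕ) t * deriv (deriv f) t
      = n * (n + 1) / q * ∫ t in Ioi (0 : ℝ), P (n + 2) j t * Dt f t := by
    rw [← integral_const_mul]
    exact setIntegral_congr_fun measurableSet_Ioi hPf
  have key := integral_P_mul_deriv_deriv hn j hf hf' hf'' hM (hi1.sub hi2)
  rw [integral_sub hi1 hi2, e1, e2] at key
  have hv0 : v n j f = (n + 1) * I (j - 1) + P (n + 1) j 0 * f 0 := by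
    rw [P_apply_zero]
    rcases j with _ | j
    · simp [v, hIdef, P_of_neg]
    · simp [v, hIdef]
  have hv1 : v n (j + 1) f = (n + 1) * I j := by simp [v, hIdef]
  have hv2 : v n (j + 1 + 1) f = (n + 1) * I (j + 1) := by simp [v, hIdef]
  have hvD : v n (j + 1) (Dt f) = (n + 1) * ∫ t in Ioi (0 : ℝ), P (n + 2) j t * Dt f t := by
    simp [v]
  rw [coeffDt, ← hq, Nat.add_sub_cancel, hv0, hv1, hv2, hvD]
  field_simp at key
  linear_combination key

theorem Dt_Vt_comm (n : ℕ) (hn : 1 ≤ n) (f : ℝ → ℝ) (hf : BddContOn f)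
    (hfW : MemW20 f) (hDfW : MemW20 (Dt f))
    (hDf_cont : ContinuousOn (Dt f) (Set.Ioi 0))
    (hDf_bdd : ∃ M, ∀ x ∈ Set.Ioi (0 : ℝ), |Dt f x| ≤ M)
    (hD2f_cont : ContinuousOn (Dt (Dt f)) (Set.Ioi 0))
    (hD2f_bdd : ∃ M, ∀ x ∈ Set.Ioi (0 : ℝ), |Dt (Dt f) x| ≤ M) :
    ∀ x ∈ Set.Ioi (0 : ℝ), Dt (Vt n f) x = Vt n (Dt f) x := by
  intro x hx
  obtain ⟨B, hB⟩ := hf.2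
  obtain ⟨M, hM⟩ := hDf_bdd
  have hv := polyGrowth_v n (g := f) fun t ht => hB t (mem_Ici.2 (le_of_lt ht))
  have hw := hv.sub ((hv.coeffDt n).const_mul (1 / (n : ℝ)))
  have hloc : Vt n f =ᶠ[nhds x] baskakovSeries n
      (fun k => v n k f - 1 / (n : ℝ) * coeffDt n (fun j => v n j f) k) := by
    filter_upwards [Ioi_mem_nhds hx] with y hy
    exact Vt_eq_baskakovSeries n hv hy
  have hcongr : ∀ {g h : ℝ → ℝ}, g =ᶠ[nhds x] h → Dt g x = Dt h x := by
    intro g h hgh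
    rw [Dt, Dt, hgh.deriv.deriv_eq]
  rw [hcongr hloc, Dt_baskakovSeries n hw hx, Vt_eq_baskakovSeries n (polyGrowth_v n hM) hx]
  simp only [v_Dt hn hf hfW.1 hDf_cont]
  congr 1
  funext k
  simp only [coeffDt]
  ring
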